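/- arXiv:2505.22527 — 3 statements merged into one kernel-verified Lean document; each statement's English description precedes it below -/
import Mathlib

section
/- Let d be a positive integer, h ∈ ℝ, and let F, G : ℝ^d → ℝ^d be measurable maps. Then the leapfrog step L_h : ℝ^d × ℝ^d → ℝ^d × ℝ^d is measure preserving with respect to the product of Lebesgue measures. -/
open MeasureTheory

/-- The leapfrog step with step size `h` for "force" `F` and "velocity" `G`:
`p_half = p - (h/2)•F q`, `q' = q + h•G p_half`, `p' = p_half - (h/2)•F q'`. -/
noncomputable def leapfrogStep (d : ℕ) (h : ℝ) (F G : (Fin d → ℝ) → (Fin d → ℝ)) :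
    ((Fin d → ℝ) × (Fin d → ℝ)) → ((Fin d → ℝ) × (Fin d → ℝ)) := fun z =>
  let pHalf := z.2 - (h / 2) • F z.1
  let q' := z.1 + h • G pHalf
  (q', pHalf - (h / 2) • F q')

theorem shear_aux (d : ℕ) (K : (Fin d → ℝ) → (Fin d → ℝ)) (hK : Measurable K) :
    MeasurePreserving (fun z : (Fin d → ℝ) × (Fin d → ℝ) => (z.1, z.2 + K z.1))
      ((volume : Measure (Fin d → ℝ)).prod (volume : Measure (Fin d → ℝ)))
      ((volume : Measure (Fin d → ℝ)).prod (volume : Measure (Fin d → ℝ))) := by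
  refine (MeasurePreserving.id (volume : Measure (Fin d → ℝ))).skew_product
    (g := fun a c => c + K a) ?_ ?_
  · exact measurable_snd.add (hK.comp measurable_fst)
  · exact Filter.Eventually.of_forall fun a => map_add_right_eq_self _ _

/-- For measurable `F, G : ℝ^d → ℝ^d` and any step size `h`, the leapfrog step is
measure preserving for the product of Lebesgue measures on `ℝ^d × ℝ^d`. -/
theorem leapfrogStep_measurePreserving (d : ℕ) (hd : 0 < d) (h : ℝ)
    (F G : (Fin d → ℝ) → (Fin d → ℝ)) (hF : Measurable F) (hG : Measurable G) :
    MeasurePreserving (leapfrogStep d h F G)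
      ((volume : Measure (Fin d → ℝ)).prod (volume : Measure (Fin d → ℝ)))
      ((volume : Measure (Fin d → ℝ)).prod (volume : Measure (Fin d → ℝ))) := by
  have h1 := shear_aux d (fun q => -((h / 2) • F q)) (hF.const_smul (h / 2)).neg
  have h2 := shear_aux d (fun p => h • G p) (hG.const_smul h)
  have hs := Measure.measurePreserving_swap (μ := (volume : Measure (Fin d → ℝ)))
    (ν := (volume : Measure (Fin d → ℝ)))
  have key := h1.comp (hs.comp (h2.comp (hs.comp h1)))
  convert key using 1
  funext z
  simp [leapfrogStep, sub_eq_add_neg]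
end

section
/- Fix ω > 0 and let R(h) be the exact-flow matrix of the harmonic oscillator, the 2×2 real matrix with first row (cos(ωh), sin(ωh)/ω) and second row (-ω·sin(ωh), cos(ωh)). Then there exists a constant C > 0 such that for all h with |h| ≤ 1 and all indices i, j, the entrywise difference satisfies |(M(h,ω) - R(h)) i j| ≤ C·|h|³; i.e., the leapfrog step has local error of order O(h³) for the harmonic oscillator. -/
open Matrix

/-- The harmonic-oscillator leapfrog matrix for `H(q,p) = p²/2 + ω²q²/2`
with step size `h`. -/
noncomputable def leapfrogMatrix (h ω : ℝ) : Matrix (Fin 2) (Fin 2) ℝ :=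
  !![1 - h ^ 2 * ω ^ 2 / 2, h;
     -h * ω ^ 2 * (1 - h ^ 2 * ω ^ 2 / 4), 1 - h ^ 2 * ω ^ 2 / 2]

/-- The exact time-`h` flow matrix of the harmonic oscillator `H(q,p) = p²/2 + ω²q²/2`. -/
noncomputable def exactFlowMatrix (ω h : ℝ) : Matrix (Fin 2) (Fin 2) ℝ :=
  !![Real.cos (ω * h), Real.sin (ω * h) / ω;
     -ω * Real.sin (ω * h), Real.cos (ω * h)]

theorem aux_cos (x : ℝ) : |1 - x ^ 2 / 2 - Real.cos x| ≤ |x| ^ 3 := by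
  have h3 : 0 ≤ |x| ^ 3 := by positivity
  rcases le_total |x| 1 with h | h
  · have h1 := Real.cos_bound h
    rw [abs_sub_comm] at h1
    have h2 : |x| ^ 4 ≤ |x| ^ 3 := pow_le_pow_of_le_one (abs_nonneg x) h (by norm_num)
    linarith
  · have h1 := Real.one_sub_sq_div_two_le_cos (x := x)
    have h2 := Real.cos_le_one x
    have h4 : |x| ^ 2 ≤ |x| ^ 3 := pow_le_pow_right₀ h (by norm_num)
    rw [sq_abs] at h4
    rw [abs_le]
    constructor <;> nlinarith [sq_nonneg x]

theorem aux_sin (x : ℝ) : |x - Real.sin x| ≤ |x| ^ 3 / 6 := by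
  rcases le_total 0 x with h | h
  · rw [abs_of_nonneg h, abs_of_nonneg (sub_nonneg.2 (Real.sin_le h))]
    have := Real.sin_ge_sub_cube h
    linarith
  · have h0 : 0 ≤ -x := by linarith
    have h1 := Real.sin_ge_sub_cube h0
    have h2 := Real.sin_le h0
    rw [Real.sin_neg] at h1 h2
    rw [abs_of_nonpos h, abs_of_nonpos (by linarith)]
    linarith

/-- The leapfrog step has local error of order `O(h³)` for the harmonic oscillator:
for `ω > 0` there is a constant `C > 0` bounding all entries of
`M(h,ω) - R(h)` by `C·|h|³` for `|h| ≤ 1`. -/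
theorem leapfrog_local_error (ω : ℝ) (hω : 0 < ω) :
    ∃ C : ℝ, 0 < C ∧ ∀ h : ℝ, |h| ≤ 1 → ∀ i j : Fin 2,
      |(leapfrogMatrix h ω - exactFlowMatrix ω h) i j| ≤ C * |h| ^ 3 := by
  refine ⟨ω ^ 2 + ω ^ 3 + ω ^ 4, by positivity, fun h _ i j => ?_⟩
  have hc := aux_cos (ω * h)
  have hs := aux_sin (ω * h)
  rw [abs_mul ω h, abs_of_pos hω, mul_pow ω |h|] at hc hs
  have hk : 0 ≤ |h| ^ 3 := by positivity
  have p2 : 0 ≤ ω ^ 2 * |h| ^ 3 := by positivity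
  have p3 : 0 ≤ ω ^ 3 * |h| ^ 3 := by positivity
  have p4 : 0 ≤ ω ^ 4 * |h| ^ 3 := by positivity
  have e00 : |1 - h ^ 2 * ω ^ 2 / 2 - Real.cos (ω * h)| ≤ (ω ^ 2 + ω ^ 3 + ω ^ 4) * |h| ^ 3 := by
    have : 1 - h ^ 2 * ω ^ 2 / 2 - Real.cos (ω * h)
        = 1 - (ω * h) ^ 2 / 2 - Real.cos (ω * h) := by ring
    rw [this]
    linarith
  have e01 : |h - Real.sin (ω * h) / ω| ≤ (ω ^ 2 + ω ^ 3 + ω ^ 4) * |h| ^ 3 := by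
    have : h - Real.sin (ω * h) / ω = (ω * h - Real.sin (ω * h)) / ω := by field_simp
    rw [this, abs_div, abs_of_pos hω, div_le_iff₀ hω]
    have q4 : 0 ≤ ω ^ 5 * |h| ^ 3 := by positivity
    nlinarith
  have e10 : |-h * ω ^ 2 * (1 - h ^ 2 * ω ^ 2 / 4) - -ω * Real.sin (ω * h)|
      ≤ (ω ^ 2 + ω ^ 3 + ω ^ 4) * |h| ^ 3 := by
    have : -h * ω ^ 2 * (1 - h ^ 2 * ω ^ 2 / 4) - -ω * Real.sin (ω * h)
        = ω ^ 4 / 4 * h ^ 3 - ω * (ω * h - Real.sin (ω * h)) := by ring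
    rw [this]
    refine (abs_sub _ _).trans ?_
    rw [abs_mul, abs_mul, abs_of_pos hω, abs_pow, abs_of_pos (by positivity : 0 < ω ^ 4 / 4)]
    have := mul_le_mul_of_nonneg_left hs hω.le
    nlinarith
  fin_cases i <;> fin_cases j <;>
    simp only [leapfrogMatrix, exactFlowMatrix, Matrix.sub_apply]
  · exact e00
  · exact e01
  · exact e10
  · exact e00
end

section
/- For all real numbers h, ω, q, p, the quadratic form Q(q,p) = ω²·(1 - h²ω²/4)·q² + p² is exactly conserved by the harmonic-oscillator leapfrog step: if (q', p') = M(h,ω)·(q,p), then Q(q',p') = Q(q,p). Thus the leapfrog integrator exactly preserves a modified (shadow) Hamiltonian that differs from the true energy ½p² + ½ω²q² by a term of order h². -/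
open Matrix

/-- The leapfrog step for the harmonic oscillator exactly conserves the modified
(shadow) quadratic energy `Q(q,p) = ω²(1 - h²ω²/4)q² + p²`. -/
theorem leapfrog_conserves_shadow_hamiltonian (h ω q p : ℝ) :
    ω ^ 2 * (1 - h ^ 2 * ω ^ 2 / 4) * ((leapfrogMatrix h ω).mulVec ![q, p] 0) ^ 2 +
        ((leapfrogMatrix h ω).mulVec ![q, p] 1) ^ 2 =
      ω ^ 2 * (1 - h ^ 2 * ω ^ 2 / 4) * q ^ 2 + p ^ 2 := by
  simp only [leapfrogMatrix, Matrix.mulVec, dotProduct, Fin.sum_univ_two, Matrix.of_apply, Matrix.cons_val_zero, Matrix.cons_val_one]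
  ring
end
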